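/- arXiv:2310.14333 — 6 statements merged into one kernel-verified Lean document; each statement's English description precedes it below -/
import Mathlib

section
/- Let V be a real vector space, let a, s : V × V → ℝ be bilinear forms, let N, B, G : V → ℝ be nonnegative functions, and let q_β, q_γ ≥ 0 be constants such that: N(v)² = a(v,v) for all v ∈ V; |s(w,v)| ≤ B(w)·G(v) for all w,v ∈ V; B(w)² ≤ q_β·N(w)² for all w ∈ V; and G(v)² ≤ q_γ·N(v)² for all v ∈ V. Suppose u, uₙ, uₙ₊₁ ∈ V and a linear functional ℓ : V → ℝ satisfy a(u,v) = s(u,v) + ℓ(v) for all v ∈ V, and a(uₙ₊₁,v) = s(uₙ,v) + ℓ(v) for all v ∈ V. Then N(u − uₙ₊₁) ≤ √(q_β·q_γ)·N(u − uₙ). -/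
/-- Abstract contraction estimate for source iteration. -/
theorem source_iteration_contraction
    {V : Type*} [AddCommGroup V] [Module ℝ V]
    (a s : V →ₗ[ℝ] V →ₗ[ℝ] ℝ) (N B G : V → ℝ) (qβ qγ : ℝ)
    (hN0 : ∀ v, 0 ≤ N v) (hB0 : ∀ v, 0 ≤ B v) (hG0 : ∀ v, 0 ≤ G v)
    (hqβ : 0 ≤ qβ) (hqγ : 0 ≤ qγ)
    (hNa : ∀ v, (N v) ^ 2 = a v v)
    (hs : ∀ w v, |s w v| ≤ B w * G v)
    (hB : ∀ w, (B w) ^ 2 ≤ qβ * (N w) ^ 2)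
    (hG : ∀ v, (G v) ^ 2 ≤ qγ * (N v) ^ 2)
    (ℓ : V →ₗ[ℝ] ℝ) (u un un1 : V)
    (hu : ∀ v, a u v = s u v + ℓ v)
    (hun1 : ∀ v, a un1 v = s un v + ℓ v) :
    N (u - un1) ≤ Real.sqrt (qβ * qγ) * N (u - un) := by
  set e := u - un1
  set w := u - un
  have error_eq : a e e = s w e := by
    simp only [e, w, map_sub, LinearMap.sub_apply]
    linarith [hu u, hu un1, hun1 u, hun1 un1]
  have hB' : B w ≤ √qβ * N w := by
    rw [← Real.sqrt_sq (hN0 w), ← Real.sqrt_mul hqβ]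
    exact Real.le_sqrt_of_sq_le (hB w)
  have hG' : G e ≤ √qγ * N e := by
    rw [← Real.sqrt_sq (hN0 e), ← Real.sqrt_mul hqγ]
    exact Real.le_sqrt_of_sq_le (hG e)
  have energy_le : N e * N e ≤ √(qβ * qγ) * N w * N e :=
    calc N e * N e = s w e := by rw [← sq, hNa, error_eq]
      _ ≤ B w * G e := (le_abs_self _).trans (hs w e)
      _ ≤ (√qβ * N w) * (√qγ * N e) :=
        mul_le_mul hB' hG' (hG0 e) ((hB0 w).trans hB')
      _ = √(qβ * qγ) * N w * N e := by rw [Real.sqrt_mul hqβ]; ring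
  rcases (hN0 e).eq_or_lt with h | h
  · rw [← h]
    exact mul_nonneg (Real.sqrt_nonneg _) (hN0 w)
  · exact le_of_mul_le_mul_right energy_le h
end

section
/- Let V be a real vector space, let a, s : V × V → ℝ be bilinear forms, let M, B, G : V → ℝ be nonnegative functions, and let r_γ ≥ 0 be a constant such that: M(v)² ≤ a(v,v) − s(v,v) for all v ∈ V; |s(w,v)| ≤ B(w)·G(v) for all w,v ∈ V; and G(v)² ≤ r_γ·M(v)² for all v ∈ V. Suppose u, uₙ, uₙ₊₁ ∈ V and a linear functional ℓ : V → ℝ satisfy a(u,v) = s(u,v) + ℓ(v) for all v ∈ V, and a(uₙ₊₁,v) = s(uₙ,v) + ℓ(v) for all v ∈ V. Then M(u − uₙ₊₁) ≤ √r_γ · B(uₙ − uₙ₊₁). -/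
/-- Abstract a posteriori solver error bound for source iteration. -/
theorem source_iteration_aposteriori
    {V : Type*} [AddCommGroup V] [Module ℝ V]
    (a s : V →ₗ[ℝ] V →ₗ[ℝ] ℝ) (M B G : V → ℝ) (rγ : ℝ)
    (hM0 : ∀ v, 0 ≤ M v) (hB0 : ∀ v, 0 ≤ B v) (hG0 : ∀ v, 0 ≤ G v)
    (hrγ : 0 ≤ rγ)
    (hcoer : ∀ v, (M v) ^ 2 ≤ a v v - s v v)
    (hs : ∀ w v, |s w v| ≤ B w * G v)
    (hG : ∀ v, (G v) ^ 2 ≤ rγ * (M v) ^ 2)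
    (ℓ : V →ₗ[ℝ] ℝ) (u un un1 : V)
    (hu : ∀ v, a u v = s u v + ℓ v)
    (hun1 : ∀ v, a un1 v = s un v + ℓ v) :
    M (u - un1) ≤ Real.sqrt rγ * B (un - un1) := by
  set e := u - un1
  have hres : a e e - s e e = -s (un - un1) e := by
    have h₁ : a e e = a u e - a un1 e := a.map_sub₂ u un1 e
    have h₂ : s e e = s u e - s un1 e := s.map_sub₂ u un1 e
    rw [h₁, h₂, hu, hun1, s.map_sub₂]
    ring
  have hGe : G e ≤ Real.sqrt rγ * M e := by
    refine le_of_abs_le <| abs_le_of_sq_le_sq ?_ (mul_nonneg (Real.sqrt_nonneg _) (hM0 e))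
    rw [mul_pow, Real.sq_sqrt hrγ]
    exact hG e
  have hsq : M e * M e ≤ Real.sqrt rγ * B (un - un1) * M e :=
    calc M e * M e = M e ^ 2 := (sq _).symm
      _ ≤ -s (un - un1) e := hres ▸ hcoer e
      _ ≤ |s (un - un1) e| := neg_le_abs _
      _ ≤ B (un - un1) * G e := hs _ _
      _ ≤ B (un - un1) * (Real.sqrt rγ * M e) := mul_le_mul_of_nonneg_left hGe (hB0 _)
      _ = Real.sqrt rγ * B (un - un1) * M e := by ring
  rcases (hM0 e).eq_or_lt with h | h
  · rw [← h]
    exact mul_nonneg (Real.sqrt_nonneg _) (hB0 _)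
  · exact le_of_mul_le_mul_right hsq h
end

section
/- Let V be a real vector space, let a, s : V × V → ℝ be bilinear forms, let N : V → ℝ be a nonnegative function with N(v)² = a(v,v) for all v ∈ V, and let c ∈ [0,1) be a constant such that |s(w,v)| ≤ c·N(w)·N(v) for all w,v ∈ V. Let ℓ : V → ℝ be a linear functional, let u ∈ V satisfy a(u,v) = s(u,v) + ℓ(v) for all v ∈ V, and let (uₙ)ₙ≥0 be a sequence in V with a(uₙ₊₁,v) = s(uₙ,v) + ℓ(v) for all v ∈ V and all n ≥ 0. Then N(u − uₙ) ≤ cⁿ·N(u − u₀) for all n ≥ 0; in particular N(u − uₙ) → 0 as n → ∞. -/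
/-- Convergence corollary for source iteration: geometric decay and convergence. -/
theorem source_iteration_convergence
    {V : Type*} [AddCommGroup V] [Module ℝ V]
    (a s : V →ₗ[ℝ] V →ₗ[ℝ] ℝ) (N : V → ℝ) (c : ℝ)
    (hN0 : ∀ v, 0 ≤ N v)
    (hNa : ∀ v, (N v) ^ 2 = a v v)
    (hc0 : 0 ≤ c) (hc1 : c < 1)
    (hs : ∀ w v, |s w v| ≤ c * N w * N v)
    (ℓ : V →ₗ[ℝ] ℝ) (u : V) (useq : ℕ → V)
    (hu : ∀ v, a u v = s u v + ℓ v)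
    (hiter : ∀ n, ∀ v, a (useq (n + 1)) v = s (useq n) v + ℓ v) :
    (∀ n, N (u - useq n) ≤ c ^ n * N (u - useq 0)) ∧
      Filter.Tendsto (fun n => N (u - useq n)) Filter.atTop (nhds 0) := by
  have step : ∀ n, N (u - useq (n + 1)) ≤ c * N (u - useq n) := by
    intro n
    have error_eq : a (u - useq (n + 1)) (u - useq (n + 1)) =
        s (u - useq n) (u - useq (n + 1)) := by
      simp only [map_sub a, map_sub s, LinearMap.sub_apply, hu, hiter]
      ring
    have hsq : N (u - useq (n + 1)) * N (u - useq (n + 1)) ≤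
        c * N (u - useq n) * N (u - useq (n + 1)) := by
      rw [← sq, hNa, error_eq]
      exact (le_abs_self _).trans (hs _ _)
    rcases (hN0 (u - useq (n + 1))).eq_or_lt with h | h
    · rw [← h]
      exact mul_nonneg hc0 (hN0 _)
    · exact le_of_mul_le_mul_right hsq h
  have bound : ∀ n, N (u - useq n) ≤ c ^ n * N (u - useq 0) := by
    intro n
    induction n with
    | zero => simp
    | succ n ih =>
      calc N (u - useq (n + 1)) ≤ c * N (u - useq n) := step n
        _ ≤ c * (c ^ n * N (u - useq 0)) := by gcongr
        _ = c ^ (n + 1) * N (u - useq 0) := by ring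
  refine ⟨bound, squeeze_zero (fun n => hN0 _) bound ?_⟩
  simpa using (tendsto_pow_atTop_nhds_zero_of_lt_one hc0 hc1).mul_const (N (u - useq 0))
end

section
/- Let V be a real vector space, let a, s, m : V × V → ℝ be bilinear forms with m symmetric and m(v,v) ≥ 0 for all v ∈ V, let ω, r, q ≥ 0 be constants, and let N : V → ℝ be a nonnegative function such that: N(v)² = a(v,v) − ω·m(v,v) for all v ∈ V; |s(w,v) − ω·m(w,v)| ≤ r·m(w,w)^{1/2}·m(v,v)^{1/2} for all w,v ∈ V; and m(v,v) ≤ q·N(v)² for all v ∈ V. Suppose u, uₙ, uₙ₊₁ ∈ V and a linear functional ℓ : V → ℝ satisfy a(u,v) = s(u,v) + ℓ(v) for all v ∈ V, and a(uₙ₊₁,v) − ω·m(uₙ₊₁,v) = s(uₙ,v) − ω·m(uₙ,v) + ℓ(v) for all v ∈ V. Then N(u − uₙ₊₁) ≤ r·q·N(u − uₙ). -/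
/-- Abstract contraction estimate for generalised source iteration. -/
theorem generalised_source_iteration_contraction
    {V : Type*} [AddCommGroup V] [Module ℝ V]
    (a s m : V →ₗ[ℝ] V →ₗ[ℝ] ℝ)
    (hmsymm : ∀ w v, m w v = m v w) (hm0 : ∀ v, 0 ≤ m v v)
    (ω r q : ℝ) (hω : 0 ≤ ω) (hr : 0 ≤ r) (hq : 0 ≤ q)
    (N : V → ℝ) (hN0 : ∀ v, 0 ≤ N v)
    (hNa : ∀ v, (N v) ^ 2 = a v v - ω * m v v)
    (hs : ∀ w v, |s w v - ω * m w v| ≤ r * Real.sqrt (m w w) * Real.sqrt (m v v))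
    (hmq : ∀ v, m v v ≤ q * (N v) ^ 2)
    (ℓ : V →ₗ[ℝ] ℝ) (u un un1 : V)
    (hu : ∀ v, a u v = s u v + ℓ v)
    (hun1 : ∀ v, a un1 v - ω * m un1 v = s un v - ω * m un v + ℓ v) :
    N (u - un1) ≤ r * q * N (u - un) := by
  have hsqrt : ∀ v, √(m v v) ≤ √q * N v := fun v => by
    rw [← Real.sqrt_sq (hN0 v), ← Real.sqrt_mul hq]
    exact Real.sqrt_le_sqrt (hmq v)
  have herr : (N (u - un1)) ^ 2 = s (u - un) (u - un1) - ω * m (u - un) (u - un1) := by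
    have h₁ := hu (u - un1)
    have h₂ := hun1 (u - un1)
    rw [hNa, map_sub a, map_sub m u un1, map_sub s, map_sub m u un]
    simp only [LinearMap.sub_apply]
    linarith
  have hsq : N (u - un1) * N (u - un1) ≤ r * q * N (u - un) * N (u - un1) :=
    calc N (u - un1) * N (u - un1)
        = s (u - un) (u - un1) - ω * m (u - un) (u - un1) := by rw [← herr, sq]
      _ ≤ r * √(m (u - un) (u - un)) * √(m (u - un1) (u - un1)) :=
        (le_abs_self _).trans (hs _ _)
      _ ≤ r * (√q * N (u - un)) * (√q * N (u - un1)) := by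
        have := hN0 (u - un)
        gcongr <;> exact hsqrt _
      _ = r * (√q * √q) * N (u - un) * N (u - un1) := by ring
      _ = r * q * N (u - un) * N (u - un1) := by rw [Real.mul_self_sqrt hq]
  rcases (hN0 (u - un1)).eq_or_lt with h | h
  · rw [← h]
    exact mul_nonneg (mul_nonneg hr hq) (hN0 _)
  · exact le_of_mul_le_mul_right hsq h
end

section
/- Let V be a real vector space, let a, s, m : V × V → ℝ be bilinear forms with m symmetric and m(v,v) ≥ 0 for all v ∈ V, let ω, r, ρ ≥ 0 be constants, and let M : V → ℝ be a nonnegative function such that: M(v)² ≤ a(v,v) − s(v,v) for all v ∈ V; |s(w,v) − ω·m(w,v)| ≤ r·m(w,w)^{1/2}·m(v,v)^{1/2} for all w,v ∈ V; and m(v,v) ≤ ρ·M(v)² for all v ∈ V. Suppose u, uₙ, uₙ₊₁ ∈ V and a linear functional ℓ : V → ℝ satisfy a(u,v) = s(u,v) + ℓ(v) for all v ∈ V, and a(uₙ₊₁,v) − ω·m(uₙ₊₁,v) = s(uₙ,v) − ω·m(uₙ,v) + ℓ(v) for all v ∈ V. Then M(u − uₙ₊₁) ≤ r·√ρ·m(uₙ₊₁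 − uₙ, uₙ₊₁ − uₙ)^{1/2}. -/
/-- Abstract a posteriori solver error bound for generalised source iteration. -/
theorem generalised_source_iteration_aposteriori
    {V : Type*} [AddCommGroup V] [Module ℝ V]
    (a s m : V →ₗ[ℝ] V →ₗ[ℝ] ℝ)
    (hmsymm : ∀ w v, m w v = m v w) (hm0 : ∀ v, 0 ≤ m v v)
    (ω r ρ : ℝ) (hω : 0 ≤ ω) (hr : 0 ≤ r) (hρ : 0 ≤ ρ)
    (M : V → ℝ) (hM0 : ∀ v, 0 ≤ M v)
    (hcoer : ∀ v, (M v) ^ 2 ≤ a v v - s v v)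
    (hs : ∀ w v, |s w v - ω * m w v| ≤ r * Real.sqrt (m w w) * Real.sqrt (m v v))
    (hmρ : ∀ v, m v v ≤ ρ * (M v) ^ 2)
    (ℓ : V →ₗ[ℝ] ℝ) (u un un1 : V)
    (hu : ∀ v, a u v = s u v + ℓ v)
    (hun1 : ∀ v, a un1 v - ω * m un1 v = s un v - ω * m un v + ℓ v) :
    M (u - un1) ≤ r * Real.sqrt ρ * Real.sqrt (m (un1 - un) (un1 - un)) := by
  set e := u - un1 with he
  set d := un1 - un with hd
  have residual : a e e - s e e = s d e - ω * m d e := by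
    have h₁ := hu e
    have h₂ := hun1 e
    have h₃ : a e e = a u e - a un1 e := by
      rw [← LinearMap.sub_apply, ← map_sub, ← he]
    have h₄ : s e e = s u e - s un1 e := by
      rw [← LinearMap.sub_apply, ← map_sub, ← he]
    have h₅ : s d e = s un1 e - s un e := by
      rw [← LinearMap.sub_apply, ← map_sub, ← hd]
    have h₆ : m d e = m un1 e - m un e := by
      rw [← LinearMap.sub_apply, ← map_sub, ← hd]
    rw [h₃, h₄, h₅, h₆]
    linarith
  have sqrt_m_le : Real.sqrt (m e e) ≤ Real.sqrt ρ * M e := by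
    rw [← Real.sqrt_sq (hM0 e), ← Real.sqrt_mul hρ]
    exact Real.sqrt_le_sqrt (hmρ e)
  have sq_le : M e ^ 2 ≤ r * Real.sqrt ρ * Real.sqrt (m d d) * M e :=
    calc M e ^ 2 ≤ s d e - ω * m d e := residual ▸ hcoer e
      _ ≤ r * Real.sqrt (m d d) * Real.sqrt (m e e) := (le_abs_self _).trans (hs d e)
      _ ≤ r * Real.sqrt (m d d) * (Real.sqrt ρ * M e) := by gcongr
      _ = r * Real.sqrt ρ * Real.sqrt (m d d) * M e := by ring
  rcases (hM0 e).eq_or_lt with h | h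
  · rw [← h]
    positivity
  · exact le_of_mul_le_mul_right (by rwa [← sq]) h
end

section
/- Let V be a real vector space, let a, s, m : V × V → ℝ be bilinear forms with m symmetric and m(v,v) ≥ 0 for all v ∈ V, let ω ≥ 0, let N : V → ℝ be a nonnegative function with N(v)² = a(v,v) − ω·m(v,v) for all v ∈ V, and let r, q ≥ 0 with r·q < 1 be constants such that |s(w,v) − ω·m(w,v)| ≤ r·m(w,w)^{1/2}·m(v,v)^{1/2} and m(v,v) ≤ q·N(v)² for all w,v ∈ V. Let ℓ : V → ℝ be a linear functional, let u ∈ V satisfy a(u,v) = s(u,v) + ℓ(v) for all v ∈ V, and let (uₙ)ₙ≥0 be a sequence in V with a(uₙ₊₁,v) − ω·m(uₙ₊₁,v) = s(uₙ,v) − ω·m(uₙ,v) + ℓ(v) for all v ∈ V and all n ≥ 0. Then N(u − uₙ) ≤ (r·q)ⁿ·N(u − u₀) for all n ≥ 0; in particular N(u − uₙ) → 0 as n → ∞. -/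
/-- If `(a - ω m)(f, f) = (s - ω m)(e, f)`, then the energy norm of `f` is at most `r * q` times
that of `e`. -/
lemma energy_norm_le_of_residual_eq {V : Type*} [AddCommGroup V] [Module ℝ V]
    {a s m : V →ₗ[ℝ] V →ₗ[ℝ] ℝ} {ω : ℝ} {N : V → ℝ} (hN0 : ∀ v, 0 ≤ N v)
    (hNa : ∀ v, (N v) ^ 2 = a v v - ω * m v v)
    {r q : ℝ} (hr : 0 ≤ r) (hq : 0 ≤ q)
    (hs : ∀ w v, |s w v - ω * m w v| ≤ r * Real.sqrt (m w w) * Real.sqrt (m v v))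
    (hmq : ∀ v, m v v ≤ q * (N v) ^ 2) {e f : V}
    (he : a f f - ω * m f f = s e f - ω * m e f) :
    N f ≤ r * q * N e := by
  have hsqrt : ∀ v, Real.sqrt (m v v) ≤ Real.sqrt q * N v := fun v => by
    simpa [Real.sqrt_mul hq, Real.sqrt_sq (hN0 v)] using Real.sqrt_le_sqrt (hmq v)
  have hsq : N f * N f ≤ r * q * N e * N f :=
    calc N f * N f = s e f - ω * m e f := by rw [← he, ← hNa, sq]
      _ ≤ r * Real.sqrt (m e e) * Real.sqrt (m f f) := (le_abs_self _).trans (hs e f)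
      _ ≤ r * (Real.sqrt q * N e) * (Real.sqrt q * N f) := by
        have := hN0 e
        gcongr
        exacts [hsqrt e, hsqrt f]
      _ = r * (Real.sqrt q * Real.sqrt q) * N e * N f := by ring
      _ = r * q * N e * N f := by rw [Real.mul_self_sqrt hq]
  rcases (hN0 f).eq_or_lt with h | h
  · rw [← h]
    exact mul_nonneg (mul_nonneg hr hq) (hN0 e)
  · exact le_of_mul_le_mul_right hsq h

/-- Convergence corollary for generalised source iteration. -/
theorem generalised_source_iteration_convergence
    {V : Type*} [AddCommGroup V] [Module ℝ V]
    (a s m : V →ₗ[ℝ] V →ₗ[ℝ] ℝ)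
    (hmsymm : ∀ w v, m w v = m v w) (hm0 : ∀ v, 0 ≤ m v v)
    (ω : ℝ) (hω : 0 ≤ ω)
    (N : V → ℝ) (hN0 : ∀ v, 0 ≤ N v)
    (hNa : ∀ v, (N v) ^ 2 = a v v - ω * m v v)
    (r q : ℝ) (hr : 0 ≤ r) (hq : 0 ≤ q) (hrq : r * q < 1)
    (hs : ∀ w v, |s w v - ω * m w v| ≤ r * Real.sqrt (m w w) * Real.sqrt (m v v))
    (hmq : ∀ v, m v v ≤ q * (N v) ^ 2)
    (ℓ : V →ₗ[ℝ] ℝ) (u : V) (useq : ℕ → V)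
    (hu : ∀ v, a u v = s u v + ℓ v)
    (hiter : ∀ n, ∀ v,
      a (useq (n + 1)) v - ω * m (useq (n + 1)) v = s (useq n) v - ω * m (useq n) v + ℓ v) :
    (∀ n, N (u - useq n) ≤ (r * q) ^ n * N (u - useq 0)) ∧
      Filter.Tendsto (fun n => N (u - useq n)) Filter.atTop (nhds 0) := by
  have hstep : ∀ n, N (u - useq (n + 1)) ≤ r * q * N (u - useq n) := fun n => by
    refine energy_norm_le_of_residual_eq hN0 hNa hr hq hs hmq ?_
    have h₁ := hu (u - useq (n + 1))
    have h₂ := hiter n (u - useq (n + 1))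
    simp only [map_sub, LinearMap.sub_apply] at h₁ h₂ ⊢
    linarith
  have hrq0 : 0 ≤ r * q := mul_nonneg hr hq
  have hbound : ∀ n, N (u - useq n) ≤ (r * q) ^ n * N (u - useq 0) := fun n => by
    induction n with
    | zero => simp
    | succ n ih =>
      calc N (u - useq (n + 1)) ≤ r * q * N (u - useq n) := hstep n
        _ ≤ r * q * ((r * q) ^ n * N (u - useq 0)) := by gcongr
        _ = (r * q) ^ (n + 1) * N (u - useq 0) := by ring
  refine ⟨hbound, squeeze_zero (fun n => hN0 _) hbound ?_⟩
  simpa using (tendsto_pow_atTop_nhds_zero_of_lt_one hrq0 hrq).mul_const (N (u - useq 0))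
end
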